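/- arXiv:2109.05655 — 2 statements merged into one kernel-verified Lean document; each statement's English description precedes it below -/
import Mathlib

section
/- For every n ≥ 0, the n-qubit real Clifford group C_n is a finite group whose cardinality equals 2 · ∏_{i=1}^{n} (4^i + 2^i − 2)(2 · 4^{i−1}). -/
open Matrix

noncomputable section

namespace RealStab

abbrev Mat (n : ℕ) := Matrix (Fin n → Fin 2) (Fin n → Fin 2) ℝ

/-- The real Pauli matrix `X`. -/
def X2 : Matrix (Fin 2) (Fin 2) ℝ := !![0, 1; 1, 0]

/-- The real Pauli matrix `Z`. -/
def Z2 : Matrix (Fin 2) (Fin 2) ℝ := !![1, 0; 0, -1]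

/-- The set `{I, X, Z, XZ}` of single-qubit Pauli matrices. -/
def pauliSet : Set (Matrix (Fin 2) (Fin 2) ℝ) := {1, X2, Z2, X2 * Z2}

/-- The `n`-fold Kronecker (tensor) product `P 0 ⊗ ⋯ ⊗ P (n-1)`, represented as a
matrix indexed by functions `Fin n → Fin 2` (a `2^n × 2^n` matrix). -/
def tensorN {n : ℕ} (P : Fin n → Matrix (Fin 2) (Fin 2) ℝ) : Mat n :=
  Matrix.of fun x y => ∏ i, P i (x i) (y i)

/-- The `n`-qubit real Pauli group `P_n`, as a set of `2^n × 2^n` real matrices. -/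
def PauliGroup (n : ℕ) : Set (Mat n) :=
  { M | ∃ a : Fin 2, ∃ P : Fin n → Matrix (Fin 2) (Fin 2) ℝ,
      (∀ i, P i ∈ pauliSet) ∧ M = (-1 : ℝ) ^ (a : ℕ) • tensorN P }


/-- The `n`-qubit real Clifford group `C_n`: orthogonal matrices normalizing `P_n`. -/
def CliffordGroup (n : ℕ) : Set (Mat n) :=
  { U | U ∈ Matrix.orthogonalGroup (Fin n → Fin 2) ℝ ∧
        ∀ P ∈ PauliGroup n, U * P * U⁻¹ ∈ PauliGroup n }

/-! ### Single-qubit Pauli matrices -/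

lemma X2_mem : X2 ∈ pauliSet := by simp [pauliSet]

lemma Z2_mem : Z2 ∈ pauliSet := by simp [pauliSet]

lemma one_mem_pauliSet : (1 : Matrix (Fin 2) (Fin 2) ℝ) ∈ pauliSet := by simp [pauliSet]

lemma XZ2_mem : X2 * Z2 ∈ pauliSet := by simp [pauliSet]

lemma X2_mul_X2 : X2 * X2 = 1 := by
  ext i j; fin_cases i <;> fin_cases j <;> simp [X2]

lemma Z2_mul_Z2 : Z2 * Z2 = 1 := by
  ext i j; fin_cases i <;> fin_cases j <;> simp [Z2]

lemma Z2_mul_X2 : Z2 * X2 = -(X2 * Z2) := by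
  ext i j; fin_cases i <;> fin_cases j <;> simp [X2, Z2]

lemma X2_transpose : X2ᵀ = X2 := by
  ext i j; fin_cases i <;> fin_cases j <;> simp [X2]

lemma Z2_transpose : Z2ᵀ = Z2 := by
  ext i j; fin_cases i <;> fin_cases j <;> simp [Z2]

lemma X2_mul_cancel (M : Matrix (Fin 2) (Fin 2) ℝ) : X2 * (X2 * M) = M := by
  rw [← mul_assoc, X2_mul_X2, one_mul]

lemma Z2_mul_cancel (M : Matrix (Fin 2) (Fin 2) ℝ) : Z2 * (Z2 * M) = M := by
  rw [← mul_assoc, Z2_mul_Z2, one_mul]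

lemma Z2_mul_X2_mul (M : Matrix (Fin 2) (Fin 2) ℝ) : Z2 * (X2 * M) = -(X2 * (Z2 * M)) := by
  rw [← mul_assoc, Z2_mul_X2, neg_mul, mul_assoc]

lemma pauliSet_mul {Q R : Matrix (Fin 2) (Fin 2) ℝ} (hQ : Q ∈ pauliSet) (hR : R ∈ pauliSet) :
    Q * R ∈ pauliSet ∨ -(Q * R) ∈ pauliSet := by
  rcases hQ with rfl | rfl | rfl | rfl <;> rcases hR with rfl | rfl | rfl | rfl <;>
    simp [pauliSet, mul_assoc, X2_mul_X2, Z2_mul_Z2, Z2_mul_X2, X2_mul_cancel, Z2_mul_X2_mul]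

lemma pauliSet_commute {Q R : Matrix (Fin 2) (Fin 2) ℝ} (hQ : Q ∈ pauliSet)
    (hR : R ∈ pauliSet) : Q * R = R * Q ∨ Q * R = -(R * Q) := by
  rcases hQ with rfl | rfl | rfl | rfl <;> rcases hR with rfl | rfl | rfl | rfl <;>
    simp [mul_assoc, X2_mul_X2, Z2_mul_Z2, Z2_mul_X2, X2_mul_cancel, Z2_mul_X2_mul]

lemma pauliSet_transpose {Q : Matrix (Fin 2) (Fin 2) ℝ} (hQ : Q ∈ pauliSet) :
    Qᵀ = Q ∨ Qᵀ = -Q := by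
  rcases hQ with rfl | rfl | rfl | rfl <;> simp [X2_transpose, Z2_transpose, Z2_mul_X2]

lemma pauliSet_orthogonal {Q : Matrix (Fin 2) (Fin 2) ℝ} (hQ : Q ∈ pauliSet) :
    Q * Qᵀ = 1 := by
  rcases hQ with rfl | rfl | rfl | rfl <;>
    simp [X2_transpose, Z2_transpose, mul_assoc, X2_mul_X2, Z2_mul_Z2, Z2_mul_cancel]

/-! ### Splitting off the first tensor factor -/

/-- The Kronecker product of a one-qubit matrix with an `n`-qubit matrix. -/
def kron {n : ℕ} (Q : Matrix (Fin 2) (Fin 2) ℝ) (M : Mat n) : Mat (n + 1) :=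
  Matrix.of fun x y => Q (x 0) (y 0) * M (Fin.tail x) (Fin.tail y)

variable {n : ℕ}

lemma kron_mul (Q R : Matrix (Fin 2) (Fin 2) ℝ) (M N : Mat n) :
    kron Q M * kron R N = kron (Q * R) (M * N) := by
  ext x y
  simp only [kron, Matrix.mul_apply, Matrix.of_apply]
  rw [Finset.sum_mul_sum, ← Fintype.sum_prod_type',
    ← (Fin.consEquiv fun _ : Fin (n + 1) => Fin 2).sum_comp]
  refine Finset.sum_congr rfl fun p _ => ?_
  simp [Fin.consEquiv]
  ring

lemma kron_transpose (Q : Matrix (Fin 2) (Fin 2) ℝ) (M : Mat n) :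
    (kron Q M)ᵀ = kron Qᵀ Mᵀ := rfl

lemma kron_one_one : kron 1 (1 : Mat n) = 1 := by
  ext x y
  by_cases h : x = y
  · subst h
    simp [kron]
  · have : ¬ (x 0 = y 0 ∧ Fin.tail x = Fin.tail y) := fun ⟨h0, ht⟩ => h <| by
      rw [← Fin.cons_self_tail x, ← Fin.cons_self_tail y, h0, ht]
    simp only [kron, Matrix.of_apply, Matrix.one_apply, h, if_false]
    split_ifs <;> simp_all

lemma kron_neg (Q : Matrix (Fin 2) (Fin 2) ℝ) (M : Mat n) : kron Q (-M) = -kron Q M := by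
  ext; simp [kron]

lemma neg_kron (Q : Matrix (Fin 2) (Fin 2) ℝ) (M : Mat n) : kron (-Q) M = -kron Q M := by
  ext; simp [kron]

lemma kron_smul (c : ℝ) (Q : Matrix (Fin 2) (Fin 2) ℝ) (M : Mat n) :
    kron Q (c • M) = c • kron Q M := by
  ext; simp [kron]; ring

lemma tensorN_succ (P : Fin (n + 1) → Matrix (Fin 2) (Fin 2) ℝ) :
    tensorN P = kron (P 0) (tensorN (Fin.tail P)) := by
  ext x y
  simp [tensorN, kron, Fin.prod_univ_succ, Fin.tail]

/-- The sum of the two blocks in the first block column. It recovers `M` from `kron Q M`. -/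
def colSum (N : Mat (n + 1)) : Mat n :=
  Matrix.of fun x y => N (Fin.cons 0 x) (Fin.cons 0 y) + N (Fin.cons 1 x) (Fin.cons 0 y)

lemma colSum_kron {Q : Matrix (Fin 2) (Fin 2) ℝ} (hQ : Q ∈ pauliSet) (M : Mat n) :
    colSum (kron Q M) = M := by
  ext x y
  rcases hQ with rfl | rfl | rfl | rfl <;> simp [colSum, kron, X2, Z2, Matrix.one_apply]

lemma kron_right_injective {Q : Matrix (Fin 2) (Fin 2) ℝ} (hQ : Q ∈ pauliSet) :
    Function.Injective (kron Q : Mat n → Mat (n + 1)) :=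
  Function.LeftInverse.injective (colSum_kron hQ)

lemma kron_left_injective {M : Mat n} (hM : M ≠ 0) :
    Function.Injective fun Q => kron Q M := by
  intro Q R h
  obtain ⟨x, y, hxy⟩ : ∃ x y, M x y ≠ 0 := by
    by_contra! h0
    exact hM (Matrix.ext h0)
  ext i j
  have := congrFun (congrFun h (Fin.cons i x)) (Fin.cons j y)
  simpa [kron, hxy] using this

lemma kron_eq_kron {Q R : Matrix (Fin 2) (Fin 2) ℝ} (hQ : Q ∈ pauliSet) (hR : R ∈ pauliSet)
    {M N : Mat n} (hM : M ≠ 0) (h : kron Q M = kron R N) : Q = R := by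
  have hMN : M = N := by rw [← colSum_kron hQ M, h, colSum_kron hR]
  subst hMN
  exact kron_left_injective hM h

/-- A matrix commuting with `X ⊗ 1` and `Z ⊗ 1` has the form `1 ⊗ M`. -/
lemma exists_eq_kron_one {U : Mat (n + 1)} (hX : U * kron X2 1 = kron X2 1 * U)
    (hZ : U * kron Z2 1 = kron Z2 1 * U) : ∃ M, U = kron 1 M := by
  have mul_kron : ∀ (Q : Matrix (Fin 2) (Fin 2) ℝ) i j x y,
      (U * kron Q (1 : Mat n)) (Fin.cons i x) (Fin.cons j y)
        = ∑ k, U (Fin.cons i x) (Fin.cons k y) * Q k j := by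
    intro Q i j x y
    rw [Matrix.mul_apply, ← (Fin.consEquiv fun _ : Fin (n + 1) => Fin 2).sum_comp,
      Fintype.sum_prod_type]
    simp [kron, Fin.consEquiv, Matrix.one_apply]
  have kron_mul' : ∀ (Q : Matrix (Fin 2) (Fin 2) ℝ) i j x y,
      (kron Q (1 : Mat n) * U) (Fin.cons i x) (Fin.cons j y)
        = ∑ k, Q i k * U (Fin.cons k x) (Fin.cons j y) := by
    intro Q i j x y
    rw [Matrix.mul_apply, ← (Fin.consEquiv fun _ : Fin (n + 1) => Fin 2).sum_comp,
      Fintype.sum_prod_type]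
    simp [kron, Fin.consEquiv, Matrix.one_apply]
  refine ⟨Matrix.of fun x y => U (Fin.cons 0 x) (Fin.cons 0 y), ?_⟩
  have key : ∀ i j x y, U (Fin.cons i x) (Fin.cons j y)
      = kron 1 (Matrix.of fun x y => U (Fin.cons 0 x) (Fin.cons 0 y))
        (Fin.cons i x) (Fin.cons j y) := by
    intro i j x y
    have h1 := congrFun (congrFun hX (Fin.cons 0 x)) (Fin.cons 1 y)
    have h2 := congrFun (congrFun hZ (Fin.cons 0 x)) (Fin.cons 1 y)
    have h3 := congrFun (congrFun hZ (Fin.cons 1 x)) (Fin.cons 0 y)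
    rw [mul_kron, kron_mul'] at h1 h2 h3
    simp [X2, Z2, Fin.sum_univ_two] at h1 h2 h3
    fin_cases i <;> fin_cases j <;> simp [kron, Matrix.one_apply] <;> linarith
  ext x y
  have := key (x 0) (y 0) (Fin.tail x) (Fin.tail y)
  rwa [Fin.cons_self_tail, Fin.cons_self_tail] at this

/-! ### The Pauli group -/

lemma mem_pauliGroup_zero {M : Mat 0} : M ∈ PauliGroup 0 ↔ M = 1 ∨ M = -1 := by
  have hT : ∀ P : Fin 0 → Matrix (Fin 2) (Fin 2) ℝ, tensorN P = 1 := by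
    intro P
    ext x y
    rw [Subsingleton.elim x y]
    simp [tensorN]
  constructor
  · rintro ⟨a, P, -, rfl⟩
    fin_cases a <;> simp [hT]
  · rintro (rfl | rfl)
    · exact ⟨0, Fin.elim0, fun i => i.elim0, by simp [hT]⟩
    · exact ⟨1, Fin.elim0, fun i => i.elim0, by simp [hT]⟩

lemma mem_pauliGroup_succ {M : Mat (n + 1)} :
    M ∈ PauliGroup (n + 1) ↔ ∃ Q ∈ pauliSet, ∃ N ∈ PauliGroup n, M = kron Q N := by
  constructor
  · rintro ⟨a, P, hP, rfl⟩
    exact ⟨P 0, hP 0, _, ⟨a, Fin.tail P, fun i => hP i.succ, rfl⟩, by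
      rw [tensorN_succ, kron_smul]⟩
  · rintro ⟨Q, hQ, N, ⟨a, P, hP, rfl⟩, rfl⟩
    refine ⟨a, Fin.cons Q P, Fin.cases hQ hP, ?_⟩
    rw [tensorN_succ, kron_smul, Fin.cons_zero, Fin.tail_cons]

lemma kron_mem {Q : Matrix (Fin 2) (Fin 2) ℝ} (hQ : Q ∈ pauliSet) {M : Mat n}
    (hM : M ∈ PauliGroup n) : kron Q M ∈ PauliGroup (n + 1) :=
  mem_pauliGroup_succ.2 ⟨Q, hQ, M, hM, rfl⟩

lemma one_mem_pauliGroup : ∀ n, (1 : Mat n) ∈ PauliGroup n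
  | 0 => mem_pauliGroup_zero.2 (Or.inl rfl)
  | n + 1 => kron_one_one (n := n) ▸ kron_mem one_mem_pauliSet (one_mem_pauliGroup n)

lemma neg_mem_pauliGroup {M : Mat n} (hM : M ∈ PauliGroup n) : -M ∈ PauliGroup n := by
  obtain ⟨a, P, hP, rfl⟩ := hM
  fin_cases a
  · exact ⟨1, P, hP, by simp⟩
  · exact ⟨0, P, hP, by simp⟩

lemma mul_mem_pauliGroup : ∀ {n : ℕ} {M N : Mat n}, M ∈ PauliGroup n → N ∈ PauliGroup n →
    M * N ∈ PauliGroup n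
  | 0, M, N, hM, hN => by
    rw [mem_pauliGroup_zero] at *
    rcases hM with rfl | rfl <;> rcases hN with rfl | rfl <;> simp
  | n + 1, _, _, hM', hN' => by
    obtain ⟨Q, hQ, M, hM, rfl⟩ := mem_pauliGroup_succ.1 hM'
    obtain ⟨R, hR, N, hN, rfl⟩ := mem_pauliGroup_succ.1 hN'
    have hMN := mul_mem_pauliGroup hM hN
    rw [kron_mul]
    rcases pauliSet_mul hQ hR with h | h
    · exact kron_mem h hMN
    · simpa [neg_kron] using neg_mem_pauliGroup (kron_mem h hMN)

lemma pauliGroup_transpose : ∀ {n : ℕ} {M : Mat n}, M ∈ PauliGroup n → Mᵀ = M ∨ Mᵀ = -M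
  | 0, M, hM => by
    rcases mem_pauliGroup_zero.1 hM with rfl | rfl <;> simp
  | n + 1, _, hM' => by
    obtain ⟨Q, hQ, M, hM, rfl⟩ := mem_pauliGroup_succ.1 hM'
    rw [kron_transpose]
    rcases pauliSet_transpose hQ with h | h <;> rcases pauliGroup_transpose hM with h' | h' <;>
      simp [h, h', neg_kron, kron_neg]

lemma pauliGroup_orthogonal : ∀ {n : ℕ} {M : Mat n}, M ∈ PauliGroup n → M * Mᵀ = 1
  | 0, M, hM => by
    rcases mem_pauliGroup_zero.1 hM with rfl | rfl <;> simp
  | n + 1, _, hM' => by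
    obtain ⟨Q, hQ, M, hM, rfl⟩ := mem_pauliGroup_succ.1 hM'
    rw [kron_transpose, kron_mul, pauliSet_orthogonal hQ, pauliGroup_orthogonal hM, kron_one_one]

lemma pauliGroup_commute : ∀ {n : ℕ} {M N : Mat n}, M ∈ PauliGroup n → N ∈ PauliGroup n →
    M * N = N * M ∨ M * N = -(N * M)
  | 0, M, N, hM, hN => by
    rw [mem_pauliGroup_zero] at *
    rcases hM with rfl | rfl <;> rcases hN with rfl | rfl <;> simp
  | n + 1, _, _, hM', hN' => by
    obtain ⟨Q, hQ, M, hM, rfl⟩ := mem_pauliGroup_succ.1 hM'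
    obtain ⟨R, hR, N, hN, rfl⟩ := mem_pauliGroup_succ.1 hN'
    rw [kron_mul, kron_mul]
    rcases pauliSet_commute hQ hR with h | h <;> rcases pauliGroup_commute hM hN with h' | h' <;>
      simp [h, h', neg_kron, kron_neg]

lemma ne_zero_of_mem_pauliGroup {M : Mat n} (hM : M ∈ PauliGroup n) : M ≠ 0 := by
  rintro rfl
  simpa using pauliGroup_orthogonal hM

lemma finite_pauliGroup : ∀ n, (PauliGroup n).Finite
  | 0 => (Set.toFinite {1, -1}).subset fun _ h => mem_pauliGroup_zero.1 h
  | n + 1 => by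
    have hfin : pauliSet.Finite := by simp [pauliSet]
    refine (hfin.image2 kron (finite_pauliGroup n)).subset fun M hM => ?_
    obtain ⟨Q, hQ, N, hN, rfl⟩ := mem_pauliGroup_succ.1 hM
    exact ⟨Q, hQ, N, hN, rfl⟩

/-- Every Pauli matrix other than `±1` anticommutes with a symmetric Pauli matrix. -/
lemma exists_anticommute : ∀ {n : ℕ} {A : Mat n}, A ∈ PauliGroup n → A ≠ 1 → A ≠ -1 →
    ∃ B ∈ PauliGroup n, Bᵀ = B ∧ A * B = -(B * A)
  | 0, A, hA, h1, h2 => by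
    rcases mem_pauliGroup_zero.1 hA with rfl | rfl <;> contradiction
  | n + 1, A, hA, h1, h2 => by
    obtain ⟨Q, hQ, M, hM, rfl⟩ := mem_pauliGroup_succ.1 hA
    have hone := one_mem_pauliGroup n
    rcases hQ with rfl | rfl | rfl | rfl
    · obtain ⟨B, hB, hBs, hAB⟩ := exists_anticommute hM
        (by rintro rfl; exact h1 kron_one_one)
        (by rintro rfl; exact h2 (by rw [kron_neg, kron_one_one]))
      exact ⟨kron 1 B, kron_mem one_mem_pauliSet hB, by simp [kron_transpose, hBs],
        by simp [kron_mul, hAB, kron_neg]⟩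
    · exact ⟨kron Z2 1, kron_mem Z2_mem hone, by simp [kron_transpose, Z2_transpose],
        by simp [kron_mul, Z2_mul_X2, neg_kron]⟩
    · exact ⟨kron X2 1, kron_mem X2_mem hone, by simp [kron_transpose, X2_transpose],
        by simp [kron_mul, Z2_mul_X2, neg_kron]⟩
    · exact ⟨kron X2 1, kron_mem X2_mem hone, by simp [kron_transpose, X2_transpose],
        by simp [kron_mul, mul_assoc, Z2_mul_X2, neg_kron]⟩

/-! ### The Clifford group -/

lemma mem_cliffordGroup {U : Mat n} : U ∈ CliffordGroup n ↔
    U * Uᵀ = 1 ∧ ∀ P ∈ PauliGroup n, U * P * Uᵀ ∈ PauliGroup n := by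
  have h : U ∈ Matrix.orthogonalGroup (Fin n → Fin 2) ℝ ↔ U * Uᵀ = 1 :=
    Matrix.mem_orthogonalGroup_iff _ _
  simp only [CliffordGroup, Set.mem_ofPred_eq, h]
  refine and_congr_right fun hU => ?_
  rw [Matrix.inv_eq_right_inv hU]

lemma conj_mul (U V P : Mat n) : U * V * P * (U * V)ᵀ = U * (V * P * Vᵀ) * Uᵀ := by
  simp only [Matrix.transpose_mul, mul_assoc]

lemma mul_mem_cliffordGroup {U V : Mat n} (hU : U ∈ CliffordGroup n)
    (hV : V ∈ CliffordGroup n) : U * V ∈ CliffordGroup n := by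
  rw [mem_cliffordGroup] at *
  refine ⟨?_, fun P hP => ?_⟩
  · have := conj_mul U V 1
    simpa [hV.1, hU.1] using this
  · rw [conj_mul]
    exact hU.2 _ (hV.2 P hP)

lemma transpose_mul_self_of_mem {U : Mat n} (hU : U ∈ CliffordGroup n) : Uᵀ * U = 1 :=
  mul_eq_one_comm.1 (mem_cliffordGroup.1 hU).1

lemma conj_transpose_conj {U : Mat n} (hU : Uᵀ * U = 1) (P : Mat n) :
    Uᵀ * (U * P * Uᵀ) * U = P := by
  calc Uᵀ * (U * P * Uᵀ) * U = (Uᵀ * U) * P * (Uᵀ * U) := by simp only [mul_assoc]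
    _ = P := by simp [hU]

lemma transpose_mem_cliffordGroup {U : Mat n} (hU : U ∈ CliffordGroup n) :
    Uᵀ ∈ CliffordGroup n := by
  have hU' := transpose_mul_self_of_mem hU
  rw [mem_cliffordGroup] at *
  refine ⟨by simpa using hU', fun P hP => ?_⟩
  have hinj : Set.InjOn (fun P => U * P * Uᵀ) (PauliGroup n) := fun P _ P' _ h => by
    rw [← conj_transpose_conj hU' P, ← conj_transpose_conj hU' P']
    exact congrArg (fun M => Uᵀ * M * U) h
  obtain ⟨P', hP', rfl⟩ :=
    (((finite_pauliGroup n).injOn_iff_bijOn_of_mapsTo hU.2).1 hinj).surjOn hP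
  simpa only [Matrix.transpose_transpose, conj_transpose_conj hU'] using hP'

lemma kron_one_mem_cliffordGroup {U : Mat n} :
    kron 1 U ∈ CliffordGroup (n + 1) ↔ U ∈ CliffordGroup n := by
  have hconj : ∀ Q P, kron 1 U * kron Q P * (kron 1 U)ᵀ = kron Q (U * P * Uᵀ) := by
    intro Q P
    simp [kron_transpose, kron_mul]
  have horth : kron 1 U * (kron 1 U)ᵀ = kron 1 (U * Uᵀ) := by
    simp [kron_transpose, kron_mul]
  rw [mem_cliffordGroup, mem_cliffordGroup, horth]
  constructor
  · rintro ⟨h1, h2⟩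
    refine ⟨kron_right_injective one_mem_pauliSet (h1.trans kron_one_one.symm),
      fun P hP => ?_⟩
    have h := h2 _ (kron_mem one_mem_pauliSet hP)
    rw [hconj] at h
    obtain ⟨Q, hQ, N, hN, h⟩ := mem_pauliGroup_succ.1 h
    rwa [← colSum_kron one_mem_pauliSet (U * P * Uᵀ), h, colSum_kron hQ]
  · rintro ⟨h1, h2⟩
    refine ⟨by rw [h1, kron_one_one], fun P hP => ?_⟩
    obtain ⟨Q, hQ, N, hN, rfl⟩ := mem_pauliGroup_succ.1 hP
    rw [hconj]
    exact kron_mem hQ (h2 N hN)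

/-- Anticommuting symmetric Pauli matrices `A`, `B` are exchanged by the Clifford matrix
`(A + B) / √2`. -/
lemma exists_clifford_swap {A B : Mat n} (hA : A ∈ PauliGroup n) (hB : B ∈ PauliGroup n)
    (hAs : Aᵀ = A) (hBs : Bᵀ = B) (hAB : A * B = -(B * A)) :
    ∃ U ∈ CliffordGroup n, U * A * Uᵀ = B := by
  have hAA : A * A = 1 := by simpa [hAs] using pauliGroup_orthogonal hA
  have hBB : B * B = 1 := by simpa [hBs] using pauliGroup_orthogonal hB
  have hBA : B * A = -(A * B) := by simp [hAB]
  have hconj : ∀ P : Mat n, ((√2)⁻¹ • (A + B)) * P * ((√2)⁻¹ • (A + B))ᵀ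
      = (2⁻¹ : ℝ) • ((A + B) * P * (A + B)) := by
    intro P
    have : (√2)⁻¹ * (√2)⁻¹ = (2⁻¹ : ℝ) := by
      rw [← mul_inv, Real.mul_self_sqrt (by norm_num)]
    simp only [Matrix.transpose_smul, Matrix.transpose_add, hAs, hBs, smul_mul_assoc,
      mul_smul_comm, smul_smul, this]
  have hsq : (A + B) * (A + B) = (2 : ℝ) • 1 := by
    rw [mul_add, add_mul, add_mul, hAA, hBB, hBA]
    module
  have hdiff : (A - B) * (A + B) = (2 : ℝ) • (A * B) := by
    rw [mul_add, sub_mul, sub_mul, hAA, hBB, hBA]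
    module
  refine ⟨(√2)⁻¹ • (A + B), mem_cliffordGroup.2 ⟨?_, fun P hP => ?_⟩, ?_⟩
  · have := hconj 1
    rw [mul_one, mul_one, hsq] at this
    rw [this, smul_smul]
    norm_num
  · have hPAB := mul_mem_pauliGroup hP (mul_mem_pauliGroup hA hB)
    rw [hconj]
    rcases pauliGroup_commute hA hP with h1 | h1 <;> rcases pauliGroup_commute hB hP with h2 | h2
    · have : (A + B) * P = P * (A + B) := by rw [add_mul, h1, h2, mul_add]
      rw [this, mul_assoc, hsq]
      simpa using hP
    · have : (A + B) * P = P * (A - B) := by rw [add_mul, h1, h2, mul_sub, sub_eq_add_neg]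
      rw [this, mul_assoc, hdiff]
      simpa using hPAB
    · have : (A + B) * P = -(P * (A - B)) := by rw [add_mul, h1, h2, mul_sub]; abel
      rw [this, neg_mul, mul_assoc, hdiff]
      simpa using neg_mem_pauliGroup hPAB
    · have : (A + B) * P = -(P * (A + B)) := by rw [add_mul, h1, h2, mul_add]; abel
      rw [this, neg_mul, mul_assoc, hsq]
      simpa using neg_mem_pauliGroup hP
  · have : (A + B) * A = B * (A + B) := by rw [add_mul, mul_add, hAA, hBB, add_comm]
    rw [hconj, this, mul_assoc, hsq]
    simp

/-- Two symmetric Pauli matrices anticommuting with the symmetric Pauli matrix `A` are conjugate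
under a controlled Pauli matrix, which commutes with `A`. -/
lemma exists_clifford_fixing {A B B' : Mat n} (hA : A ∈ PauliGroup n) (hB : B ∈ PauliGroup n)
    (hB' : B' ∈ PauliGroup n) (hAs : Aᵀ = A) (hBs : Bᵀ = B) (hBs' : B'ᵀ = B')
    (hAB : A * B = -(B * A)) (hAB' : A * B' = -(B' * A)) :
    ∃ U ∈ CliffordGroup n, U * A * Uᵀ = A ∧ U * B * Uᵀ = B' := by
  have hAA : A * A = 1 := by simpa [hAs] using pauliGroup_orthogonal hA
  have hBB : B * B = 1 := by simpa [hBs] using pauliGroup_orthogonal hB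
  have hBB' : B' * B' = 1 := by simpa [hBs'] using pauliGroup_orthogonal hB'
  obtain ⟨W, hW⟩ : ∃ W, W = B' * B := ⟨_, rfl⟩
  have hWm : W ∈ PauliGroup n := hW ▸ mul_mem_pauliGroup hB' hB
  have hWo := pauliGroup_orthogonal hWm
  have hAW : A * W = W * A := by
    rw [hW, ← mul_assoc, hAB', neg_mul, mul_assoc, hAB, mul_neg, neg_neg, mul_assoc]
  have hAWt : A * Wᵀ = Wᵀ * A := by
    simpa [hAs] using (congrArg Matrix.transpose hAW).symm
  have hWB : W * B = B' := by rw [hW, mul_assoc, hBB, mul_one]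
  have hBW : B * Wᵀ = B' := by
    rw [hW, Matrix.transpose_mul, hBs, hBs', ← mul_assoc, hBB, one_mul]
  have hpp : (1 + A) * (1 + A) = (2 : ℝ) • (1 + A) := by
    simp only [mul_add, add_mul, hAA, one_mul, mul_one]; module
  have hmm : (1 - A) * (1 - A) = (2 : ℝ) • (1 - A) := by
    simp only [mul_sub, sub_mul, hAA, one_mul, mul_one]; module
  have hpm : (1 + A) * (1 - A) = 0 := by
    simp only [mul_sub, add_mul, hAA, one_mul, mul_one]; abel
  have hmp : (1 - A) * (1 + A) = 0 := by
    simp only [mul_add, sub_mul, hAA, one_mul, mul_one]; abel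
  have hpW : (1 + A) * Wᵀ = Wᵀ * (1 + A) := by rw [add_mul, mul_add, hAWt, one_mul, mul_one]
  have hmW : (1 - A) * Wᵀ = Wᵀ * (1 - A) := by rw [sub_mul, mul_sub, hAWt, one_mul, mul_one]
  have hUt : ((2⁻¹ : ℝ) • ((1 + A) + W * (1 - A)))ᵀ
      = (2⁻¹ : ℝ) • ((1 + A) + Wᵀ * (1 - A)) := by
    simp [hAs, ← hmW]
  have expand_same : ∀ C : Mat n, ((1 + A) + C * (1 - A)) * ((1 + A) + Wᵀ * (1 - A))
      = (2 : ℝ) • ((1 + A) + C * Wᵀ * (1 - A)) := by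
    intro C
    have e1 : (1 + A) * (Wᵀ * (1 - A)) = 0 := by rw [← mul_assoc, hpW, mul_assoc, hpm, mul_zero]
    have e2 : (1 - A) * (Wᵀ * (1 - A)) = (2 : ℝ) • (Wᵀ * (1 - A)) := by
      rw [← mul_assoc, hmW, mul_assoc, hmm, mul_smul_comm]
    rw [add_mul, mul_add _ (1 + A) (Wᵀ * _), mul_add _ (1 + A) (Wᵀ * _), hpp, e1, mul_assoc C, mul_assoc C, hmp, e2, mul_zero,
      mul_smul_comm, mul_assoc C]
    module
  have expand_flip : ∀ C : Mat n, ((1 - A) + C * (1 + A)) * ((1 + A) + Wᵀ * (1 - A))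
      = (2 : ℝ) • (Wᵀ * (1 - A) + C * (1 + A)) := by
    intro C
    have e1 : (1 + A) * (Wᵀ * (1 - A)) = 0 := by rw [← mul_assoc, hpW, mul_assoc, hpm, mul_zero]
    have e2 : (1 - A) * (Wᵀ * (1 - A)) = (2 : ℝ) • (Wᵀ * (1 - A)) := by
      rw [← mul_assoc, hmW, mul_assoc, hmm, mul_smul_comm]
    rw [add_mul, mul_add _ (1 + A) (Wᵀ * _), mul_add _ (1 + A) (Wᵀ * _), hmp, e2, mul_assoc C, mul_assoc C, hpp, e1, mul_zero,
      mul_smul_comm]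
    module
  have conj_same : ∀ P C : Mat n, A * P = P * A → W * P = P * C →
      ((2⁻¹ : ℝ) • ((1 + A) + W * (1 - A))) * P * ((2⁻¹ : ℝ) • ((1 + A) + W * (1 - A)))ᵀ
        = (2⁻¹ : ℝ) • (P * ((1 + A) + C * Wᵀ * (1 - A))) := by
    intro P C h1 h2
    have : ((1 + A) + W * (1 - A)) * P = P * ((1 + A) + C * (1 - A)) := by
      have e : (1 - A) * P = P * (1 - A) := by rw [sub_mul, mul_sub, h1, one_mul, mul_one]
      rw [add_mul, add_mul, mul_add, mul_add, h1, one_mul, mul_one, mul_assoc, e, ← mul_assoc,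
        h2, mul_assoc]
    rw [hUt, smul_mul_assoc, smul_mul_assoc, mul_smul_comm, this, mul_assoc, expand_same,
      mul_smul_comm]
    module
  have conj_flip : ∀ P C : Mat n, A * P = -(P * A) → W * P = P * C →
      ((2⁻¹ : ℝ) • ((1 + A) + W * (1 - A))) * P * ((2⁻¹ : ℝ) • ((1 + A) + W * (1 - A)))ᵀ
        = (2⁻¹ : ℝ) • (P * (Wᵀ * (1 - A) + C * (1 + A))) := by
    intro P C h1 h2
    have : ((1 + A) + W * (1 - A)) * P = P * ((1 - A) + C * (1 + A)) := by
      have e : (1 - A) * P = P * (1 + A) := by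
        rw [sub_mul, mul_add, h1, one_mul, mul_one, sub_neg_eq_add]
      rw [add_mul, add_mul, mul_add, mul_sub P, h1, one_mul, mul_one, mul_assoc, e, ← mul_assoc,
        h2, mul_assoc, sub_eq_add_neg]
    rw [hUt, smul_mul_assoc, smul_mul_assoc, mul_smul_comm, this, mul_assoc, expand_flip,
      mul_smul_comm]
    module
  refine ⟨(2⁻¹ : ℝ) • ((1 + A) + W * (1 - A)), mem_cliffordGroup.2 ⟨?_, fun P hP => ?_⟩, ?_, ?_⟩
  · have := conj_same 1 W (by simp) (by simp)
    rw [mul_one] at this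
    rw [this, hWo, one_mul, one_mul]
    module
  · have hPA := mul_mem_pauliGroup hP hA
    have hPW := mul_mem_pauliGroup hP hWm
    have hPWA := mul_mem_pauliGroup hPW hA
    rcases pauliGroup_commute hA hP with h1 | h1 <;> rcases pauliGroup_commute hWm hP with h2 | h2
    · rw [conj_same P W h1 h2, hWo]
      convert hP using 1
      simp only [mul_add, mul_sub, mul_one, one_mul]
      module
    · rw [conj_same P (-W) h1 (by rw [h2, mul_neg]), neg_mul W, hWo]
      convert hPA using 1
      simp only [mul_add, mul_sub, mul_one, neg_mul, mul_neg, one_mul]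
      module
    · rw [conj_flip P W h1 h2]
      rcases pauliGroup_transpose hWm with h3 | h3
      · convert hPW using 1
        simp only [h3, mul_add, mul_sub, mul_one]
        module
      · convert hPWA using 1
        simp only [h3, mul_add, mul_sub, mul_one, neg_mul, mul_neg, mul_assoc]
        module
    · rw [conj_flip P (-W) h1 (by rw [h2, mul_neg])]
      rcases pauliGroup_transpose hWm with h3 | h3
      · convert neg_mem_pauliGroup hPWA using 1
        simp only [h3, mul_add, mul_sub, mul_one, neg_mul, mul_neg, mul_assoc]
        module
      · convert neg_mem_pauliGroup hPW using 1
        simp only [h3, mul_add, mul_sub, mul_one, neg_mul, mul_neg]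
        module
  · rw [conj_same A W rfl hAW.symm, hWo]
    simp only [mul_add, mul_sub, mul_one, one_mul]
    module
  · rw [conj_flip B (B * B') hAB (by rw [hWB, ← mul_assoc, hBB, one_mul])]
    simp only [mul_add, ← mul_assoc, hBW, hBB, one_mul, mul_sub, mul_one]
    module

/-- The Clifford group acts transitively on the symmetric Pauli matrices other than `±1`. -/
lemma exists_clifford_X {A : Mat (n + 1)} (hA : A ∈ PauliGroup (n + 1)) (hAs : Aᵀ = A)
    (h1 : A ≠ 1) (h2 : A ≠ -1) : ∃ U ∈ CliffordGroup (n + 1), U * kron X2 1 * Uᵀ = A := by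
  have hone := one_mem_pauliGroup n
  have hX := kron_mem X2_mem hone
  have hXs : (kron X2 (1 : Mat n))ᵀ = kron X2 1 := by simp [kron_transpose, X2_transpose]
  have via : ∀ B ∈ PauliGroup (n + 1), Bᵀ = B → kron X2 1 * B = -(B * kron X2 1) →
      B * A = -(A * B) → ∃ U ∈ CliffordGroup (n + 1), U * kron X2 1 * Uᵀ = A := by
    intro B hB hBs hXB hBA
    obtain ⟨U, hU, hUX⟩ := exists_clifford_swap hX hB hXs hBs hXB
    obtain ⟨V, hV, hVB⟩ := exists_clifford_swap hB hA hBs hAs hBA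
    exact ⟨V * U, mul_mem_cliffordGroup hV hU, by rw [conj_mul, hUX, hVB]⟩
  obtain ⟨Q, hQ, M, hM, rfl⟩ := mem_pauliGroup_succ.1 hA
  rcases hQ with rfl | rfl | rfl | rfl
  · obtain ⟨B, hB, hBs, hMB⟩ := exists_anticommute hM
      (by rintro rfl; exact h1 kron_one_one)
      (by rintro rfl; exact h2 (by rw [kron_neg, kron_one_one]))
    refine via (kron Z2 B) (kron_mem Z2_mem hB) ?_ ?_ ?_
    · rw [kron_transpose, Z2_transpose, hBs]
    · simp [kron_mul, Z2_mul_X2, neg_kron]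
    · simp [kron_mul, hMB, kron_neg]
  · refine via (kron Z2 1) (kron_mem Z2_mem hone) ?_ ?_ ?_
    · simp [kron_transpose, Z2_transpose]
    · simp [kron_mul, Z2_mul_X2, neg_kron]
    · simp [kron_mul, Z2_mul_X2, neg_kron]
  · exact exists_clifford_swap hX hA hXs hAs (by simp [kron_mul, Z2_mul_X2, neg_kron])
  · exact exists_clifford_swap hX hA hXs hAs
      (by simp [kron_mul, mul_assoc, Z2_mul_X2, neg_kron])

/-! ### Counting -/

lemma eq_zero_of_eq_neg {M : Mat n} (h : M = -M) : M = 0 := by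
  ext x y
  have := congrFun (congrFun h x) y
  rw [Matrix.neg_apply] at this
  simpa using self_eq_neg.1 this

/-- The Pauli matrices `M` with `Mᵀ = c • M`. -/
def pauliEigen (n : ℕ) (c : ℝ) : Set (Mat n) := {M | M ∈ PauliGroup n ∧ Mᵀ = c • M}

lemma finite_pauliEigen (n : ℕ) (c : ℝ) : (pauliEigen n c).Finite :=
  (finite_pauliGroup n).subset fun _ h => h.1

lemma X2_ne_one : X2 ≠ 1 := fun h => by simpa [X2] using congrFun (congrFun h 0) 0

lemma Z2_ne_one : Z2 ≠ 1 := fun h => by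
  have := congrFun (congrFun h 1) 1
  norm_num [Z2] at this

lemma XZ2_ne_one : X2 * Z2 ≠ 1 := fun h => by simpa [X2, Z2] using congrFun (congrFun h 0) 0

lemma Z2_ne_X2 : Z2 ≠ X2 := fun h => by simpa [X2, Z2] using congrFun (congrFun h 0) 0

lemma XZ2_ne_X2 : X2 * Z2 ≠ X2 := fun h => by
  have := congrFun (congrFun h 0) 1
  norm_num [X2, Z2] at this

lemma XZ2_ne_Z2 : X2 * Z2 ≠ Z2 := fun h => by simpa [X2, Z2] using congrFun (congrFun h 0) 0

lemma disjoint_kron_image {Q R : Matrix (Fin 2) (Fin 2) ℝ} (hQ : Q ∈ pauliSet)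
    (hR : R ∈ pauliSet) (h : R ≠ Q) {S T : Set (Mat n)} (hS : S ⊆ PauliGroup n) :
    Disjoint (kron Q '' S) (kron R '' T) := by
  rw [Set.disjoint_left]
  rintro _ ⟨M, hM, rfl⟩ ⟨N, -, hN⟩
  exact h (kron_eq_kron hQ hR (ne_zero_of_mem_pauliGroup (hS hM)) hN.symm).symm

lemma pauliEigen_succ (n : ℕ) (c : ℝ) : pauliEigen (n + 1) c =
    kron 1 '' pauliEigen n c ∪ (kron X2 '' pauliEigen n c ∪
      (kron Z2 '' pauliEigen n c ∪ kron (X2 * Z2) '' pauliEigen n (-c))) := by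
  have h : ∀ Q ∈ pauliSet, ∀ M N : Mat n, kron Q M = kron Q N ↔ M = N := fun Q hQ M N =>
    (kron_right_injective hQ).eq_iff
  ext A
  simp only [Set.mem_union, Set.mem_image]
  constructor
  · rintro ⟨hA, hAs⟩
    obtain ⟨Q, hQ, M, hM, rfl⟩ := mem_pauliGroup_succ.1 hA
    rw [kron_transpose, ← kron_smul] at hAs
    rcases hQ with rfl | rfl | rfl | rfl
    · rw [Matrix.transpose_one, h _ one_mem_pauliSet] at hAs
      exact Or.inl ⟨M, ⟨hM, hAs⟩, rfl⟩
    · rw [X2_transpose, h _ X2_mem] at hAs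
      exact Or.inr (Or.inl ⟨M, ⟨hM, hAs⟩, rfl⟩)
    · rw [Z2_transpose, h _ Z2_mem] at hAs
      exact Or.inr (Or.inr (Or.inl ⟨M, ⟨hM, hAs⟩, rfl⟩))
    · rw [Matrix.transpose_mul, X2_transpose, Z2_transpose, Z2_mul_X2, neg_kron, ← kron_neg,
        h _ XZ2_mem] at hAs
      exact Or.inr (Or.inr (Or.inr ⟨M, ⟨hM, by rw [neg_smul, ← hAs, neg_neg]⟩, rfl⟩))
  · rintro (⟨M, ⟨hM, hs⟩, rfl⟩ | ⟨M, ⟨hM, hs⟩, rfl⟩ | ⟨M, ⟨hM, hs⟩, rfl⟩ | ⟨M, ⟨hM, hs⟩, rfl⟩)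
    · exact ⟨kron_mem one_mem_pauliSet hM, by
        rw [kron_transpose, hs, kron_smul, Matrix.transpose_one]⟩
    · exact ⟨kron_mem X2_mem hM, by rw [kron_transpose, hs, kron_smul, X2_transpose]⟩
    · exact ⟨kron_mem Z2_mem hM, by rw [kron_transpose, hs, kron_smul, Z2_transpose]⟩
    · exact ⟨kron_mem XZ2_mem hM, by
        rw [kron_transpose, hs, kron_smul, Matrix.transpose_mul, X2_transpose, Z2_transpose,
          Z2_mul_X2, neg_kron, neg_smul, smul_neg, neg_neg]⟩

lemma ncard_pauliEigen_succ (n : ℕ) (c : ℝ) : (pauliEigen (n + 1) c).ncard =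
    3 * (pauliEigen n c).ncard + (pauliEigen n (-c)).ncard := by
  have hc : pauliEigen n c ⊆ PauliGroup n := fun _ h => h.1
  have hf := fun (Q : Matrix (Fin 2) (Fin 2) ℝ) (c : ℝ) => (finite_pauliEigen n c).image (kron Q)
  have hcard : ∀ Q ∈ pauliSet, ∀ S : Set (Mat n), (kron Q '' S).ncard = S.ncard := fun Q hQ S =>
    Set.ncard_image_of_injective S (kron_right_injective hQ)
  have I := one_mem_pauliSet
  have X := X2_mem
  have Z := Z2_mem
  have Y := XZ2_mem
  rw [pauliEigen_succ, Set.ncard_union_eq _ (hf _ _) ((hf _ _).union ((hf _ _).union (hf _ _))),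
    Set.ncard_union_eq _ (hf _ _) ((hf _ _).union (hf _ _)),
    Set.ncard_union_eq _ (hf _ _) (hf _ _), hcard _ I, hcard _ X, hcard _ Z, hcard _ Y]
  · ring
  · exact disjoint_kron_image Z Y XZ2_ne_Z2 hc
  · exact Set.disjoint_union_right.2 ⟨disjoint_kron_image X Z Z2_ne_X2 hc,
      disjoint_kron_image X Y XZ2_ne_X2 hc⟩
  · exact Set.disjoint_union_right.2 ⟨disjoint_kron_image I X X2_ne_one hc,
      Set.disjoint_union_right.2 ⟨disjoint_kron_image I Z Z2_ne_one hc,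
        disjoint_kron_image I Y XZ2_ne_one hc⟩⟩

lemma one_ne_neg_one (n : ℕ) : (1 : Mat n) ≠ -1 := fun h => by
  have := congrFun (congrFun h 0) 0
  norm_num at this

lemma ncard_pauliEigen (n : ℕ) : (pauliEigen n 1).ncard = 4 ^ n + 2 ^ n ∧
    (pauliEigen n (-1)).ncard + 2 ^ n = 4 ^ n := by
  induction n with
  | zero =>
    have h1 : pauliEigen 0 1 = {1, -1} := by
      ext M
      simp only [pauliEigen, Set.mem_ofPred_eq, mem_pauliGroup_zero, one_smul]
      refine ⟨And.left, fun h => ⟨h, ?_⟩⟩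
      rcases h with rfl | rfl <;> simp
    have h2 : pauliEigen 0 (-1) = ∅ := by
      rw [Set.eq_empty_iff_forall_notMem]
      rintro M ⟨hM, hs⟩
      rcases mem_pauliGroup_zero.1 hM with rfl | rfl
      · exact one_ne_neg_one 0 (by simpa using hs)
      · exact one_ne_neg_one 0 (by simpa using hs.symm)
    rw [h1, h2, Set.ncard_pair (one_ne_neg_one 0)]
    simp
  | succ n ih =>
    rw [ncard_pauliEigen_succ, ncard_pauliEigen_succ, neg_neg, pow_succ, pow_succ]
    omega

lemma ncard_pauliGroup (n : ℕ) : (PauliGroup n).ncard = 2 * 4 ^ n := by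
  have h : PauliGroup n = pauliEigen n 1 ∪ pauliEigen n (-1) := by
    ext M
    simp only [pauliEigen, Set.mem_union, Set.mem_ofPred_eq, one_smul, neg_smul, ← and_or_left]
    exact ⟨fun hM => ⟨hM, pauliGroup_transpose hM⟩, And.left⟩
  rw [h, Set.ncard_union_eq _ (finite_pauliEigen n 1) (finite_pauliEigen n (-1))]
  · have := ncard_pauliEigen n
    omega
  · rw [Set.disjoint_left]
    rintro M ⟨hM, h1⟩ ⟨-, h2⟩
    refine ne_zero_of_mem_pauliGroup hM ?_
    rw [h1, one_smul, neg_smul, one_smul] at h2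
    exact eq_zero_of_eq_neg h2

/-- The symmetric Pauli matrices other than `±1`. -/
def symPauli (n : ℕ) : Set (Mat n) := pauliEigen n 1 \ {1, -1}

lemma ncard_symPauli (n : ℕ) : (symPauli n).ncard = 4 ^ n + 2 ^ n - 2 := by
  rw [symPauli, Set.ncard_sdiff, ncard_pauliEigen n |>.1, Set.ncard_pair (one_ne_neg_one n)]
  rintro M (rfl | rfl)
  · exact ⟨one_mem_pauliGroup n, by simp⟩
  · exact ⟨neg_mem_pauliGroup (one_mem_pauliGroup n), by simp⟩

/-- The symmetric Pauli matrices anticommuting with `X ⊗ 1`. -/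
def antiX (n : ℕ) : Set (Mat (n + 1)) :=
  {B | B ∈ PauliGroup (n + 1) ∧ Bᵀ = B ∧ kron X2 1 * B = -(B * kron X2 1)}

lemma finite_antiX (n : ℕ) : (antiX n).Finite :=
  (finite_pauliGroup (n + 1)).subset fun _ h => h.1

lemma ncard_antiX (n : ℕ) : (antiX n).ncard = 2 * 4 ^ n := by
  rw [← ncard_pauliGroup]
  refine Set.ncard_congr (fun B _ => colSum B) ?_ ?_ ?_
  · rintro B ⟨hB, -⟩
    obtain ⟨Q, hQ, M, hM, rfl⟩ := mem_pauliGroup_succ.1 hB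
    rwa [colSum_kron hQ]
  · have factor : ∀ B ∈ antiX n, B = kron Z2 (colSum B) ∧ (colSum B)ᵀ = colSum B ∨
        B = kron (X2 * Z2) (colSum B) ∧ (colSum B)ᵀ = -colSum B := by
      rintro B ⟨hB, hBs, hXB⟩
      obtain ⟨Q, hQ, M, hM, rfl⟩ := mem_pauliGroup_succ.1 hB
      rw [colSum_kron hQ]
      have hne := mt eq_zero_of_eq_neg (ne_zero_of_mem_pauliGroup (kron_mem X2_mem hM))
      have hne' := mt eq_zero_of_eq_neg (ne_zero_of_mem_pauliGroup (kron_mem one_mem_pauliSet hM))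
      rcases hQ with rfl | rfl | rfl | rfl
      · simp only [kron_mul, one_mul, mul_one] at hXB
        exact absurd hXB hne
      · simp only [kron_mul, one_mul, mul_one, X2_mul_X2] at hXB
        exact absurd hXB hne'
      · refine Or.inl ⟨rfl, kron_right_injective Z2_mem ?_⟩
        rwa [kron_transpose, Z2_transpose] at hBs
      · refine Or.inr ⟨rfl, kron_right_injective XZ2_mem ?_⟩
        rw [kron_transpose, Matrix.transpose_mul, X2_transpose, Z2_transpose, Z2_mul_X2,
          neg_kron] at hBs
        rw [kron_neg, ← hBs, neg_neg]
    intro B B' hB hB' h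
    have hne : colSum B ≠ 0 := by
      obtain ⟨Q, hQ, M, hM, rfl⟩ := mem_pauliGroup_succ.1 hB.1
      rw [colSum_kron hQ]
      exact ne_zero_of_mem_pauliGroup hM
    have hne' := mt eq_zero_of_eq_neg hne
    rcases factor B hB with ⟨h1, h2⟩ | ⟨h1, h2⟩ <;> rcases factor B' hB' with ⟨h3, h4⟩ | ⟨h3, h4⟩
    · rw [h1, h3, h]
    · rw [← h, h2] at h4
      exact absurd h4 hne'
    · rw [← h, h2] at h4
      exact absurd h4.symm hne'
    · rw [h1, h3, h]
  · intro M hM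
    rcases pauliGroup_transpose hM with h | h
    · refine ⟨kron Z2 M, ⟨kron_mem Z2_mem hM, ?_, ?_⟩, colSum_kron Z2_mem M⟩
      · rw [kron_transpose, Z2_transpose, h]
      · simp [kron_mul, Z2_mul_X2, neg_kron]
    · refine ⟨kron (X2 * Z2) M, ⟨kron_mem XZ2_mem hM, ?_, ?_⟩, colSum_kron XZ2_mem M⟩
      · rw [kron_transpose, Matrix.transpose_mul, X2_transpose, Z2_transpose, h, Z2_mul_X2,
          neg_kron, kron_neg, neg_neg]
      · simp [kron_mul, mul_assoc, Z2_mul_X2, neg_kron]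

lemma conj_kron_one {Q : Matrix (Fin 2) (Fin 2) ℝ} {U : Mat n} (hU : U ∈ CliffordGroup n) :
    kron 1 U * kron Q 1 * (kron 1 U)ᵀ = kron Q 1 := by
  simp [kron_transpose, kron_mul, (mem_cliffordGroup.1 hU).1]

lemma commute_of_conj_eq {U P : Mat n} (hU : Uᵀ * U = 1) (h : U * P * Uᵀ = P) :
    U * P = P * U := by
  calc U * P = U * P * (Uᵀ * U) := by rw [hU, mul_one]
    _ = U * P * Uᵀ * U := by simp only [mul_assoc]
    _ = P * U := by rw [h]

/-- A Clifford matrix amounts to the images of `X ⊗ 1` and `Z ⊗ 1` under conjugation, together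
with a Clifford matrix on one qubit fewer. -/
lemma exists_bijective_clifford_succ (n : ℕ) :
    ∃ f : symPauli (n + 1) × antiX n × CliffordGroup n → CliffordGroup (n + 1),
      Function.Bijective f := by
  have hone := one_mem_pauliGroup n
  have hX := kron_mem X2_mem hone
  have hZ := kron_mem Z2_mem hone
  have hXs : (kron X2 (1 : Mat n))ᵀ = kron X2 1 := by simp [kron_transpose, X2_transpose]
  have hZs : (kron Z2 (1 : Mat n))ᵀ = kron Z2 1 := by simp [kron_transpose, Z2_transpose]
  have hXZ : kron X2 (1 : Mat n) * kron Z2 1 = -(kron Z2 1 * kron X2 1) := by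
    simp [kron_mul, Z2_mul_X2, neg_kron]
  have hV : ∀ A : symPauli (n + 1), ∃ V ∈ CliffordGroup (n + 1),
      V * kron X2 1 * Vᵀ = A.1 := by
    rintro ⟨A, ⟨hA, hAs⟩, hA1⟩
    simp only [Set.mem_insert_iff, Set.mem_singleton_iff, not_or] at hA1
    exact exists_clifford_X hA (by simpa using hAs) hA1.1 hA1.2
  choose V hVm hVX using hV
  have hW : ∀ B : antiX n, ∃ W ∈ CliffordGroup (n + 1),
      W * kron X2 1 * Wᵀ = kron X2 1 ∧ W * kron Z2 1 * Wᵀ = B.1 := by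
    rintro ⟨B, hB, hBs, hXB⟩
    exact exists_clifford_fixing hX hZ hB hXs hZs hBs hXZ hXB
  choose W hWm hWX hWZ using hW
  refine ⟨fun p => ⟨V p.1 * (W p.2.1 * kron 1 p.2.2.1), mul_mem_cliffordGroup (hVm _)
    (mul_mem_cliffordGroup (hWm _) (kron_one_mem_cliffordGroup.2 p.2.2.2))⟩, ?_, ?_⟩
  · rintro ⟨A, B, U⟩ ⟨A', B', U'⟩ h
    replace h : V A * (W B * kron 1 U) = V A' * (W B' * kron 1 U') := congrArg Subtype.val h
    have hA : A = A' := by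
      have := congrArg (fun M => M * kron X2 1 * Mᵀ) h
      simp only [conj_mul, conj_kron_one U.2, conj_kron_one U'.2, hWX, hVX] at this
      exact Subtype.ext this
    subst hA
    replace h := congrArg ((V A)ᵀ * ·) h
    simp only [← mul_assoc _ (V A), transpose_mul_self_of_mem (hVm A), one_mul] at h
    have hB : B = B' := by
      have := congrArg (fun M => M * kron Z2 1 * Mᵀ) h
      simp only [conj_mul, conj_kron_one U.2, conj_kron_one U'.2, hWZ] at this
      exact Subtype.ext this
    subst hB
    replace h := congrArg ((W B)ᵀ * ·) h
    simp only [← mul_assoc _ (W B), transpose_mul_self_of_mem (hWm B), one_mul] at h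
    rw [Subtype.ext (kron_right_injective one_mem_pauliSet h)]
  · rintro ⟨U, hU⟩
    have hUP := (mem_cliffordGroup.1 hU).2
    have hUt := transpose_mul_self_of_mem hU
    have hAs : (U * kron X2 1 * Uᵀ)ᵀ = U * kron X2 1 * Uᵀ := by
      simp [hXs, mul_assoc]
    have hne : ∀ c : ℝ, U * kron X2 1 * Uᵀ ≠ c • 1 := by
      intro c hc
      have h1 := conj_transpose_conj hUt (kron X2 1)
      rw [hc] at h1
      have h2 : kron X2 (1 : Mat n) = c • 1 := by
        rw [← h1]
        simp [hUt]
      rw [h2] at hXZ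
      simp only [smul_mul_assoc, one_mul, mul_smul_comm, mul_one] at hXZ
      rcases smul_eq_zero.1 (eq_zero_of_eq_neg hXZ) with rfl | h
      · exact ne_zero_of_mem_pauliGroup hX (by rw [h2, zero_smul])
      · exact ne_zero_of_mem_pauliGroup hZ h
    let A : symPauli (n + 1) := ⟨U * kron X2 1 * Uᵀ, ⟨hUP _ hX, by rw [hAs, one_smul]⟩, by
      simpa using And.intro (hne 1) (hne (-1))⟩
    have hU₁ := mul_mem_cliffordGroup (transpose_mem_cliffordGroup (hVm A)) hU
    obtain ⟨U₁, hU₁_eq⟩ : ∃ U₁, U₁ = (V A)ᵀ * U := ⟨_, rfl⟩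
    rw [← hU₁_eq] at hU₁
    have hU₁X : U₁ * kron X2 1 * U₁ᵀ = kron X2 1 := by
      rw [hU₁_eq, conj_mul, Matrix.transpose_transpose]
      have := conj_transpose_conj (transpose_mul_self_of_mem (hVm A)) (kron X2 1)
      rw [hVX] at this
      exact this
    have hU₁t := transpose_mul_self_of_mem hU₁
    have conj_conj : ∀ P Q : Mat (n + 1),
        U₁ * P * U₁ᵀ * (U₁ * Q * U₁ᵀ) = U₁ * (P * Q) * U₁ᵀ := by
      intro P Q
      calc _ = U₁ * P * (U₁ᵀ * U₁) * Q * U₁ᵀ := by simp only [mul_assoc]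
        _ = _ := by rw [hU₁t, mul_one]; simp only [mul_assoc]
    let B : antiX n := ⟨U₁ * kron Z2 1 * U₁ᵀ, (mem_cliffordGroup.1 hU₁).2 _ hZ,
      by simp [hZs, mul_assoc], by
        have : U₁ * kron X2 1 * U₁ᵀ * (U₁ * kron Z2 1 * U₁ᵀ)
            = -(U₁ * kron Z2 1 * U₁ᵀ * (U₁ * kron X2 1 * U₁ᵀ)) := by
          rw [conj_conj, conj_conj, hXZ, mul_neg, neg_mul]
        rwa [hU₁X] at this⟩
    have hU₂ := mul_mem_cliffordGroup (transpose_mem_cliffordGroup (hWm B)) hU₁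
    have hWt := transpose_mul_self_of_mem (hWm B)
    have hU₂t := transpose_mul_self_of_mem hU₂
    obtain ⟨U', hU'⟩ := exists_eq_kron_one (U := (W B)ᵀ * U₁)
      (commute_of_conj_eq hU₂t (by
        rw [conj_mul, hU₁X, Matrix.transpose_transpose]
        have := conj_transpose_conj hWt (kron X2 1)
        rwa [hWX] at this))
      (commute_of_conj_eq hU₂t (by
        rw [conj_mul, Matrix.transpose_transpose]
        have := conj_transpose_conj hWt (kron Z2 1)
        rwa [hWZ] at this))
    refine ⟨(A, B, ⟨U', kron_one_mem_cliffordGroup.1 (hU' ▸ hU₂)⟩), Subtype.ext ?_⟩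
    change V A * (W B * kron 1 U') = U
    rw [← hU', ← mul_assoc (W B), (mem_cliffordGroup.1 (hWm B)).1, one_mul, hU₁_eq, ← mul_assoc,
      (mem_cliffordGroup.1 (hVm A)).1, one_mul]

lemma cliffordGroup_zero : CliffordGroup 0 = {1, -1} := by
  ext U
  rw [mem_cliffordGroup]
  constructor
  · rintro ⟨hU, -⟩
    have h : ∀ c : ℝ, U 0 0 = c → U = c • 1 := by
      intro c hc
      ext x y
      rw [Subsingleton.elim x 0, Subsingleton.elim y 0, hc]
      simp
    have h00 := congrFun (congrFun hU 0) 0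
    rw [Matrix.mul_apply, Fintype.sum_subsingleton _ 0, Matrix.transpose_apply,
      Matrix.one_apply_eq] at h00
    rcases mul_self_eq_one_iff.1 h00 with h1 | h1
    · simp [h 1 h1]
    · simp [h (-1) h1]
  · rintro (rfl | rfl) <;> simp

/-- `C_n` is finite, of cardinality
`2 · ∏_{i=1}^{n} (4^i + 2^i − 2)(2 · 4^{i−1})`. -/
theorem clifford_card (n : ℕ) :
    (CliffordGroup n).Finite ∧
    (CliffordGroup n).ncard =
      2 * ∏ i ∈ Finset.range n, (4 ^ (i + 1) + 2 ^ (i + 1) - 2) * (2 * 4 ^ i) := by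
  induction n with
  | zero => simp [cliffordGroup_zero, Set.ncard_pair (one_ne_neg_one 0)]
  | succ n ih =>
    obtain ⟨f, hf⟩ := exists_bijective_clifford_succ n
    have : Finite (symPauli (n + 1)) := ((finite_pauliEigen (n + 1) 1).sdiff).to_subtype
    have := (finite_antiX n).to_subtype
    have := ih.1.to_subtype
    refine ⟨Set.finite_coe_iff.1 (Finite.of_surjective f hf.2), ?_⟩
    have hcard := Nat.card_congr (Equiv.ofBijective f hf)
    rw [Nat.card_prod, Nat.card_prod] at hcard
    simp only [Nat.card_coe_set_eq] at hcard
    rw [← hcard, ncard_symPauli, ncard_antiX, ih.2, Finset.prod_range_succ]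
    ring

end RealStab

end
end

section
/- For every n ≥ 1, the number of elements P of the n-qubit real Pauli group P_n satisfying P² = I, P ≠ I, and P ≠ −I is exactly 4^n + 2^n − 2. -/
open Matrix

noncomputable section

namespace RealStab

/-- The single-qubit real Pauli matrices `I, X, Z, XZ`, indexed by `Fin 4`. -/
def pauli : Fin 4 → Matrix (Fin 2) (Fin 2) ℝ := ![1, X2, Z2, X2 * Z2]

/-- The sign `ε` with `(pauli k)² = ε I`. -/
def pauliSign : Fin 4 → ℝ := ![1, 1, 1, -1]

/-- The signed Pauli string with sign exponent `p.1` and letters `p.2`. -/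
def pauliString {n : ℕ} (p : Fin 2 × (Fin n → Fin 4)) : Mat n :=
  (-1 : ℝ) ^ (p.1 : ℕ) • tensorN fun i => pauli (p.2 i)

lemma mem_pauliSet_iff {A : Matrix (Fin 2) (Fin 2) ℝ} : A ∈ pauliSet ↔ ∃ k, pauli k = A := by
  simp [pauliSet, pauli, Fin.exists_fin_succ, eq_comm]

lemma pauli_mul_self (k : Fin 4) : pauli k * pauli k = pauliSign k • 1 := by
  fin_cases k <;> ext i j <;> fin_cases i <;> fin_cases j <;>
    simp [pauli, pauliSign, X2, Z2, Matrix.mul_apply]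

lemma sum_pauli_mul_pauli (k l : Fin 4) :
    ∑ x, ∑ y, pauli k x y * pauli l x y = if k = l then 2 else 0 := by
  fin_cases k <;> fin_cases l <;>
    norm_num [pauli, X2, Z2, Matrix.mul_apply, Fin.sum_univ_two, Matrix.one_apply]

lemma tensorN_mul {n : ℕ} (P Q : Fin n → Matrix (Fin 2) (Fin 2) ℝ) :
    tensorN P * tensorN Q = tensorN fun i => P i * Q i := by
  ext x y
  simp only [tensorN, Matrix.mul_apply, Matrix.of_apply, ← Finset.prod_mul_distrib]
  rw [Finset.prod_univ_sum, Fintype.piFinset_univ]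

lemma tensorN_smul_one {n : ℕ} (c : Fin n → ℝ) :
    (tensorN fun i => c i • 1) = (∏ i, c i) • (1 : Mat n) := by
  ext x y
  simp only [tensorN, Matrix.of_apply, Matrix.smul_apply, smul_eq_mul, Finset.prod_mul_distrib,
    Matrix.one_apply, Fintype.prod_boole, funext_iff]
  congr!

lemma sum_tensorN_mul_tensorN {n : ℕ} (P Q : Fin n → Matrix (Fin 2) (Fin 2) ℝ) :
    ∑ x, ∑ y, tensorN P x y * tensorN Q x y = ∏ i, ∑ x, ∑ y, P i x y * Q i x y := by
  simp only [Finset.prod_univ_sum, Fintype.piFinset_univ, tensorN, Matrix.of_apply,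
    Finset.prod_mul_distrib]

lemma pauliString_mul_self {n : ℕ} (p : Fin 2 × (Fin n → Fin 4)) :
    pauliString p * pauliString p = (∏ i, pauliSign (p.2 i)) • 1 := by
  have h : (-1 : ℝ) ^ (p.1 : ℕ) * (-1) ^ (p.1 : ℕ) = 1 := by
    rw [← mul_pow]; norm_num
  simp only [pauliString, Matrix.smul_mul, Matrix.mul_smul, smul_smul, ← mul_assoc, h, one_mul,
    tensorN_mul, pauli_mul_self, tensorN_smul_one]

lemma pauliString_mul_self_eq_one_iff {n : ℕ} (p : Fin 2 × (Fin n → Fin 4)) :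
    pauliString p * pauliString p = 1 ↔ ∏ i, pauliSign (p.2 i) = 1 := by
  rw [pauliString_mul_self]
  refine ⟨fun h => ?_, fun h => by rw [h, one_smul]⟩
  simpa using congrFun (congrFun h 0) 0

lemma sum_pauliString_mul_pauliString {n : ℕ} (p q : Fin 2 × (Fin n → Fin 4)) :
    ∑ x, ∑ y, pauliString p x y * pauliString q x y =
      if p.2 = q.2 then (-1) ^ (p.1 : ℕ) * (-1) ^ (q.1 : ℕ) * 2 ^ n else 0 := by
  have h : ∏ i, (if p.2 i = q.2 i then (2 : ℝ) else 0) = if p.2 = q.2 then 2 ^ n else 0 := by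
    split_ifs with hpq
    · simp [hpq]
    · obtain ⟨i, hi⟩ := Function.ne_iff.mp hpq
      exact Finset.prod_eq_zero (Finset.mem_univ i) (if_neg hi)
  simp only [pauliString, Matrix.smul_apply, smul_eq_mul, mul_mul_mul_comm, ← Finset.mul_sum,
    sum_tensorN_mul_tensorN, sum_pauli_mul_pauli, h, mul_ite, mul_zero]

lemma pauliString_injective {n : ℕ} :
    Function.Injective (pauliString : Fin 2 × (Fin n → Fin 4) → Mat n) := by
  rintro ⟨a, f⟩ ⟨b, g⟩ h
  have hp := sum_pauliString_mul_pauliString (a, f) (a, f)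
  have hpq := sum_pauliString_mul_pauliString (a, f) (b, g)
  rw [← h, hp] at hpq
  have hn : (2 : ℝ) ^ n ≠ 0 := by positivity
  by_cases hfg : f = g
  · subst hfg
    simp only [if_true] at hpq
    have hsign := mul_right_cancel₀ hn hpq
    fin_cases a <;> fin_cases b <;> first | rfl | norm_num at hsign
  · rw [if_pos rfl, if_neg hfg] at hpq
    simp at hpq

lemma range_pauliString (n : ℕ) : Set.range (pauliString (n := n)) = PauliGroup n := by
  ext M
  constructor
  · rintro ⟨⟨a, f⟩, rfl⟩
    exact ⟨a, _, fun i => mem_pauliSet_iff.mpr ⟨f i, rfl⟩, rfl⟩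
  · rintro ⟨a, P, hP, rfl⟩
    choose f hf using fun i => mem_pauliSet_iff.mp (hP i)
    exact ⟨(a, f), by simp only [pauliString, hf]⟩

lemma pauliString_zero_right {n : ℕ} (a : Fin 2) :
    pauliString (a, (0 : Fin n → Fin 4)) = (-1 : ℝ) ^ (a : ℕ) • (1 : Mat n) := by
  have h := tensorN_smul_one fun _ : Fin n => (1 : ℝ)
  simp only [one_smul, Finset.prod_const_one] at h
  simp [pauliString, pauli, h]

lemma prod_pauliSign_eq_one_or {n : ℕ} (f : Fin n → Fin 4) :
    ∏ i, pauliSign (f i) = 1 ∨ ∏ i, pauliSign (f i) = -1 := by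
  rw [← sq_eq_one_iff, ← Finset.prod_pow]
  refine Finset.prod_eq_one fun i _ => ?_
  generalize f i = k
  fin_cases k <;> simp [pauliSign]

lemma two_mul_card_prod_pauliSign_eq_one (n : ℕ) :
    2 * {f : Fin n → Fin 4 | ∏ i, pauliSign (f i) = 1}.ncard = 4 ^ n + 2 ^ n := by
  classical
  have hsum : ∑ f : Fin n → Fin 4, ∏ i, pauliSign (f i) = 2 ^ n := by
    rw [← Fintype.piFinset_univ, ← Finset.prod_univ_sum]
    simp [pauliSign, Fin.sum_univ_succ]
    norm_num
  have hind (f : Fin n → Fin 4) :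
      2 * (if ∏ i, pauliSign (f i) = 1 then 1 else 0) = 1 + ∏ i, pauliSign (f i) := by
    rcases prod_pauliSign_eq_one_or f with h | h <;> norm_num [h]
  rw [Set.ncard_eq_toFinset_card']
  have : (2 : ℝ) * ({f : Fin n → Fin 4 | ∏ i, pauliSign (f i) = 1}.toFinset.card : ℝ) =
      4 ^ n + 2 ^ n := by
    rw [Set.toFinset_ofPred, Finset.card_filter]
    push_cast
    rw [Finset.mul_sum, Finset.sum_congr rfl fun f _ => hind f, Finset.sum_add_distrib, hsum]
    simp
  exact_mod_cast this

lemma ncard_pauliGroup_sq_eq_one (n : ℕ) :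
    {P ∈ PauliGroup n | P * P = 1}.ncard = 4 ^ n + 2 ^ n := by
  have h : {P ∈ PauliGroup n | P * P = 1} =
      pauliString '' (Set.univ ×ˢ {f | ∏ i, pauliSign (f i) = 1}) := by
    ext M
    simp only [← range_pauliString, Set.mem_ofPred_eq, Set.mem_range, Set.mem_image, Set.mem_prod,
      Set.mem_univ, true_and, ← pauliString_mul_self_eq_one_iff]
    constructor
    · rintro ⟨⟨p, rfl⟩, hp⟩
      exact ⟨p, hp, rfl⟩
    · rintro ⟨p, hp, rfl⟩
      exact ⟨⟨p, rfl⟩, hp⟩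
  rw [h, Set.ncard_image_of_injective _ pauliString_injective, Set.ncard_prod, Set.ncard_univ,
    Nat.card_eq_fintype_card, Fintype.card_fin, two_mul_card_prod_pauliSign_eq_one]

/-- For `n ≥ 1`, the number of `P ∈ P_n` with `P² = I` and `P ≠ ±I`
is exactly `4^n + 2^n − 2`. -/
theorem card_pauli_involutions (n : ℕ) (hn : 1 ≤ n) :
    {P ∈ PauliGroup n | P * P = 1 ∧ P ≠ 1 ∧ P ≠ -1}.ncard = 4 ^ n + 2 ^ n - 2 := by
  have h : {P ∈ PauliGroup n | P * P = 1 ∧ P ≠ 1 ∧ P ≠ -1} =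
      {P ∈ PauliGroup n | P * P = 1} \ {1, -1} := by
    ext P
    simp only [Set.mem_ofPred_eq, Set.mem_sdiff, Set.mem_insert_iff, Set.mem_singleton_iff, not_or,
      and_assoc]
  have hone : pauliString (0, (0 : Fin n → Fin 4)) = 1 := by simp [pauliString_zero_right]
  have hneg : pauliString (1, (0 : Fin n → Fin 4)) = -1 := by simp [pauliString_zero_right]
  have hne : (1 : Mat n) ≠ -1 := by
    rw [← hneg, ← hone]
    exact fun h => by simpa using pauliString_injective h
  have hsub : {1, -1} ⊆ {P ∈ PauliGroup n | P * P = 1} := by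
    rintro P (rfl | rfl) <;> rw [← range_pauliString]
    · exact ⟨⟨_, hone⟩, by simp⟩
    · exact ⟨⟨_, hneg⟩, by simp⟩
  rw [h, Set.ncard_sdiff hsub, ncard_pauliGroup_sq_eq_one, Set.ncard_pair hne]

end RealStab

end
end
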